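/- Let {U_α}_{α∈I} be a family of open sets in ℝ^N and U = ⋃_α U_α. Let (f_n) be a sequence in 𝒞(U) such that for each α, the restricted sequence (f_n|_{U_α}) satisfies: for every K ⋐ U_α there exists a delta sequence (φ_m) such that for each m, f_n∗φ_m ⇉ 0 on K as n → ∞. Then the same holds on U: for every K ⋐ U there exists a delta sequence (φ_m) such that for each m, f_n∗φ_m ⇉ 0 on K as n → ∞ (i.e. (f_n) ∼ (0) on U). -/

import Mathlib

open MeasureTheory Filter Topology Metric Pointwise

noncomputable section

/-- `ℝ^N` with the Euclidean metric. -/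
abbrev Euc (N : ℕ) : Type := EuclideanSpace ℝ (Fin N)

/-- `𝒟`: smooth real-valued functions with compact support on `ℝ^N`. -/
def IsTest {N : ℕ} (φ : Euc N → ℝ) : Prop :=
  ContDiff ℝ (⊤ : ℕ∞) φ ∧ HasCompactSupport φ

/-- `s(φ) = inf {ε > 0 : supp φ ⊆ B_ε}`. -/
def sRad {N : ℕ} (φ : Euc N → ℝ) : ℝ :=
  sInf {ε : ℝ | 0 < ε ∧ tsupport φ ⊆ ball (0 : Euc N) ε}

/-- `𝒟₀`: test functions that are nonnegative with integral 1. -/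
def IsD0 {N : ℕ} (φ : Euc N → ℝ) : Prop :=
  IsTest φ ∧ (∀ x, 0 ≤ φ x) ∧ (∫ x, φ x) = 1

/-- Delta sequences: sequences in `𝒟₀` with `s(φ_n) → 0`. -/
def IsDeltaSeq {N : ℕ} (φ : ℕ → Euc N → ℝ) : Prop :=
  (∀ n, IsD0 (φ n)) ∧ Tendsto (fun n => sRad (φ n)) atTop (𝓝 0)

/-- Convolution `(f∗φ)(x) = ∫ f(x−y)φ(y) dy` (with the convention that the
integrand vanishes wherever `φ` does). -/
def convol {N : ℕ} (f φ : Euc N → ℝ) : Euc N → ℝ :=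
  fun x => ∫ y, f (x - y) * φ y

/-- `A^{-ε} = (closure (Aᶜ + B_ε))ᶜ`. -/
def erode {N : ℕ} (A : Set (Euc N)) (ε : ℝ) : Set (Euc N) :=
  (closure (Aᶜ + ball (0 : Euc N) ε))ᶜ

/-- `‖f‖_K`, the sup of `|f|` over `K`. -/
def supNormOn {N : ℕ} (f : Euc N → ℝ) (K : Set (Euc N)) : ℝ :=
  ⨆ x ∈ K, |f x|

/-- Fundamental sequence on `U`: a sequence of continuous functions such that for
every compact `K ⊆ U` there is a delta sequence `δ` with `(f_n∗δ_m)_n` uniformly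
convergent on `K` for every `m` (all but finitely many `m`, per the paper's
convention on definedness of the convolutions). -/
def IsFundamental {N : ℕ} (f : ℕ → Euc N → ℝ) (U : Set (Euc N)) : Prop :=
  (∀ n, ContinuousOn (f n) U) ∧
  ∀ K : Set (Euc N), IsCompact K → K ⊆ U →
    ∃ δ : ℕ → Euc N → ℝ, IsDeltaSeq δ ∧ ∃ m₀ : ℕ, ∀ m ≥ m₀,
      ∃ g : Euc N → ℝ, TendstoUniformlyOn (fun n => convol (f n) (δ m)) g atTop K

/-- `(f_n) ∼ (g_n)` on `U`: for every compact `K ⊆ U` there is a delta sequence `φ`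
with `(f_n − g_n)∗φ_m ⇉ 0` on `K` as `n → ∞`, for every (sufficiently large) `m`. -/
def SimTo {N : ℕ} (f g : ℕ → Euc N → ℝ) (U : Set (Euc N)) : Prop :=
  ∀ K : Set (Euc N), IsCompact K → K ⊆ U →
    ∃ φ : ℕ → Euc N → ℝ, IsDeltaSeq φ ∧ ∃ m₀ : ℕ, ∀ m ≥ m₀,
      TendstoUniformlyOn (fun n => convol (fun y => f n y - g n y) (φ m)) 0 atTop K

/-- `(f_n) ∼ (0)` on `U`: for every compact `K ⊆ U` there is a delta sequence `φ`
with `f_n∗φ_m ⇉ 0` on `K` as `n → ∞` for every (sufficiently large) `m`. -/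
def SimZero {N : ℕ} (f : ℕ → Euc N → ℝ) (U : Set (Euc N)) : Prop :=
  ∀ K : Set (Euc N), IsCompact K → K ⊆ U →
    ∃ φ : ℕ → Euc N → ℝ, IsDeltaSeq φ ∧ ∃ m₀ : ℕ, ∀ m ≥ m₀,
      TendstoUniformlyOn (fun n => convol (f n) (φ m)) 0 atTop K

lemma tsupport_subset_of_sRad_lt {N : ℕ} {φ : Euc N → ℝ} (hφ : IsTest φ) {r : ℝ}
    (h : sRad φ < r) : tsupport φ ⊆ ball (0 : Euc N) r := by
  have hb : Bornology.IsBounded (tsupport φ) := IsCompact.isBounded hφ.2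
  have hne : {ε : ℝ | 0 < ε ∧ tsupport φ ⊆ ball (0 : Euc N) ε}.Nonempty := by
    obtain ⟨R, hR, hR'⟩ := hb.subset_ball_lt 0 (0 : Euc N)
    exact ⟨R, hR, hR'⟩
  obtain ⟨ε, hε, hlt⟩ := exists_lt_of_csInf_lt hne h
  exact hε.2.trans (ball_subset_ball hlt.le)

lemma sRad_le {N : ℕ} {φ : Euc N → ℝ} {r : ℝ} (hr : 0 < r)
    (h : tsupport φ ⊆ ball (0 : Euc N) r) : sRad φ ≤ r :=
  csInf_le ⟨0, fun _ hx => hx.1.le⟩ ⟨hr, h⟩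

lemma sRad_nonneg {N : ℕ} (φ : Euc N → ℝ) : 0 ≤ sRad φ :=
  Real.sInf_nonneg fun _ hx => hx.1.le

lemma tendsto_sRad {N : ℕ} {φ : ℕ → Euc N → ℝ}
    (h : ∀ r : ℝ, 0 < r → ∀ᶠ m in atTop, tsupport (φ m) ⊆ ball (0 : Euc N) r) :
    Tendsto (fun n => sRad (φ n)) atTop (𝓝 0) := by
  rw [Metric.tendsto_nhds]
  intro ε hε
  filter_upwards [h (ε / 2) (by positivity)] with m hm
  rw [Real.dist_eq, sub_zero, abs_of_nonneg (sRad_nonneg _)]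
  exact (sRad_le (by positivity) hm).trans_lt (by linarith)

lemma IsDeltaSeq.eventually {N : ℕ} {φ : ℕ → Euc N → ℝ} (h : IsDeltaSeq φ) {r : ℝ} (hr : 0 < r) :
    ∀ᶠ m in atTop, tsupport (φ m) ⊆ ball (0 : Euc N) r := by
  filter_upwards [h.2.eventually (gt_mem_nhds hr)] with m hm
  exact tsupport_subset_of_sRad_lt (h.1 m).1 hm

lemma exists_deltaSeq (N : ℕ) : ∃ φ : ℕ → Euc N → ℝ, IsDeltaSeq φ := by
  let b : ℕ → ContDiffBump (0 : Euc N) := fun n =>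
    ⟨1 / (2 * ((n : ℝ) + 1)), 1 / ((n : ℝ) + 1), by positivity, by
      apply one_div_lt_one_div_of_lt <;> linarith [(Nat.cast_nonneg n : (0 : ℝ) ≤ n)]⟩
  refine ⟨fun n => (b n).normed volume, fun n => ⟨⟨(b n).contDiff_normed,
    (b n).hasCompactSupport_normed⟩, (b n).nonneg_normed, (b n).integral_normed⟩, ?_⟩
  apply tendsto_sRad
  intro r hr
  filter_upwards [(tendsto_one_div_add_atTop_nhds_zero_nat (𝕜 := ℝ)).eventually
    (gt_mem_nhds hr)] with m hm
  rw [(b m).tsupport_normed_eq]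
  exact closedBall_subset_ball hm

lemma convol_eq {N : ℕ} (f φ : Euc N → ℝ) :
    convol f φ = convolution f φ (ContinuousLinearMap.mul ℝ ℝ) volume := by
  ext x
  exact convolution_mul_swap.symm

lemma convol_comm {N : ℕ} (f φ : Euc N → ℝ) : convol f φ = convol φ f := by
  rw [convol_eq, convol_eq, ← convolution_flip]
  congr 1
  ext
  simp

lemma IsTest.integrable {N : ℕ} {φ : Euc N → ℝ} (h : IsTest φ) : Integrable φ :=
  h.1.continuous.integrable_of_hasCompactSupport h.2

lemma tsupport_convol {N : ℕ} {φ ψ : Euc N → ℝ} (h1 : IsTest φ) (h2 : IsTest ψ) :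
    tsupport (convol φ ψ) ⊆ tsupport φ + tsupport ψ := by
  rw [convol_eq]
  refine closure_minimal ((support_convolution_subset _).trans
    (Set.add_subset_add subset_closure subset_closure)) ?_
  exact (IsCompact.add h1.2 h2.2).isClosed

lemma IsD0.convol {N : ℕ} {φ ψ : Euc N → ℝ} (h1 : IsD0 φ) (h2 : IsD0 ψ) :
    IsD0 (convol φ ψ) := by
  refine ⟨⟨?_, ?_⟩, ?_, ?_⟩
  · rw [convol_eq]
    exact h2.1.2.contDiff_convolution_right _ h1.1.integrable.locallyIntegrable h2.1.1
  · rw [convol_eq]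
    exact h1.1.2.convolution _ h2.1.2
  · intro x
    exact integral_nonneg fun y => mul_nonneg (h1.2.1 _) (h2.2.1 _)
  · rw [convol_eq, integral_convolution _ h1.1.integrable h2.1.integrable, h1.2.2, h2.2.2]
    simp

lemma IsDeltaSeq.convol {N : ℕ} {φ ψ : ℕ → Euc N → ℝ} (h1 : IsDeltaSeq φ) (h2 : IsDeltaSeq ψ) :
    IsDeltaSeq (fun m => convol (φ m) (ψ m)) := by
  refine ⟨fun m => (h1.1 m).convol (h2.1 m), tendsto_sRad fun r hr => ?_⟩
  filter_upwards [h1.eventually (half_pos hr), h2.eventually (half_pos hr)] with m hm1 hm2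
  refine (tsupport_convol (h1.1 m).1 (h2.1 m).1).trans ?_
  rintro _ ⟨a, ha, b, hb, rfl⟩
  have ha := hm1 ha
  have hb := hm2 hb
  rw [mem_ball_zero_iff] at *
  have := norm_add_le a b
  simp only
  linarith

lemma convol_congr {N : ℕ} {f g φ : Euc N → ℝ} {x : Euc N}
    (h : ∀ y, φ y ≠ 0 → f (x - y) = g (x - y)) : convol f φ x = convol g φ x := by
  unfold convol
  congr 1
  ext y
  by_cases hy : φ y = 0
  · simp [hy]
  · rw [h y hy]

lemma convol_assoc {N : ℕ} {g φ ψ : Euc N → ℝ} (hg : Integrable g) (h1 : IsTest φ)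
    (h2 : IsTest ψ) : convol (convol g φ) ψ = convol g (convol φ ψ) := by
  ext x
  simp only [convol_eq]
  have c1 : Continuous fun x => ‖φ x‖ := h1.1.continuous.norm
  have c2 : Continuous fun x => ‖ψ x‖ := h2.1.continuous.norm
  apply convolution_assoc
  · intro x y z
    simp [mul_assoc]
  · exact hg.1
  · exact h1.1.continuous.aestronglyMeasurable
  · exact h2.1.continuous.aestronglyMeasurable
  · exact Eventually.of_forall fun y => h1.2.convolutionExists_right _ hg.locallyIntegrable
      h1.1.continuous y
  · exact Eventually.of_forall fun y => h2.2.norm.convolutionExists_right _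
      (h1.integrable.norm.locallyIntegrable) c2 y
  · refine HasCompactSupport.convolutionExists_right _ ?_ hg.norm.locallyIntegrable ?_ x
    · exact h1.2.norm.convolution _ h2.2.norm
    · exact h2.2.norm.continuous_convolution_right _ h1.integrable.norm.locallyIntegrable c2

lemma abs_convol_le {N : ℕ} {f ψ : Euc N → ℝ} (h : IsD0 ψ) {x : Euc N} {η : ℝ}
    (hb : ∀ y, ψ y ≠ 0 → |f (x - y)| ≤ η) : |convol f ψ x| ≤ η := by
  unfold convol
  rw [← Real.norm_eq_abs]
  have : ∫ y, η * ψ y = η := by rw [integral_const_mul, h.2.2, mul_one]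
  rw [← this]
  refine norm_integral_le_of_norm_le (h.1.integrable.const_mul η) (Eventually.of_forall fun y => ?_)
  by_cases hy : ψ y = 0
  · simp [hy]
  · rw [norm_mul, Real.norm_eq_abs, Real.norm_eq_abs, abs_of_nonneg (h.2.1 y)]
    exact mul_le_mul_of_nonneg_right (hb y hy) (h.2.1 y)

lemma sub_mem_thickening {N : ℕ} {φ : Euc N → ℝ} {r s t : ℝ} {S : Set (Euc N)} {x y : Euc N}
    (hx : x ∈ thickening s S) (hφ : tsupport φ ⊆ ball 0 r) (hy : φ y ≠ 0) (hst : s + r ≤ t) :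
    x - y ∈ thickening t S := by
  rw [mem_thickening_iff] at *
  obtain ⟨z, hz, hxz⟩ := hx
  refine ⟨z, hz, ?_⟩
  have h1 := hφ (subset_tsupport φ hy)
  rw [mem_ball_zero_iff] at h1
  have h2 : dist (x - y) x = ‖y‖ := by simp [dist_eq_norm]
  linarith [dist_triangle (x - y) x z]

lemma key_bound {N : ℕ} {f φ ψ : Euc N → ℝ} {C S : Set (Euc N)} {r η : ℝ}
    (hC : IsCompact C) (hf : ContinuousOn f C) (h1 : IsD0 φ) (h2 : IsD0 ψ)
    (s1 : tsupport φ ⊆ ball 0 r) (s2 : tsupport ψ ⊆ ball 0 r)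
    (hS : thickening (3 * r) S ⊆ C)
    (hb : ∀ x ∈ thickening (2 * r) S, |convol f φ x| ≤ η) :
    ∀ x ∈ thickening r S, |convol f (convol φ ψ) x| ≤ η := by
  intro x hx
  have hg : Integrable (C.indicator f) :=
    (integrable_indicator_iff hC.measurableSet).2 (hf.integrableOn_compact hC)
  have e1 : convol f (convol φ ψ) x = convol (C.indicator f) (convol φ ψ) x := by
    apply convol_congr
    intro y hy
    obtain ⟨a, ha, b, hb, rfl⟩ := tsupport_convol h1.1 h2.1 (subset_tsupport _ hy)
    have : x - (a + b) ∈ C := by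
      apply hS
      have ha := s1 ha
      have hb := s2 hb
      rw [mem_ball_zero_iff] at ha hb
      rw [mem_thickening_iff] at *
      obtain ⟨z, hz, hxz⟩ := hx
      refine ⟨z, hz, ?_⟩
      have h2 : dist (x - (a + b)) x = ‖a + b‖ := by rw [dist_eq_norm, ← norm_neg]; simp
      linarith [dist_triangle (x - (a + b)) x z, norm_add_le a b]
    exact (Set.indicator_of_mem this f).symm
  rw [e1, ← convol_assoc hg h1.1 h2.1]
  apply abs_convol_le h2
  intro y hy
  have hxy : x - y ∈ thickening (2 * r) S := sub_mem_thickening hx s2 hy (by linarith)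
  rw [← convol_congr (f := f)]
  · exact hb _ hxy
  · intro z hz
    exact (Set.indicator_of_mem (hS (sub_mem_thickening hxy s1 hz (by linarith))) f).symm

/-- Local property used for the compactness induction. -/
def GoodSet {N : ℕ} (f : ℕ → Euc N → ℝ) (U S : Set (Euc N)) : Prop :=
  ∃ ε : ℝ, 0 < ε ∧ ∃ C : Set (Euc N), IsCompact C ∧ C ⊆ U ∧ thickening ε S ⊆ C ∧
    ∃ φ : ℕ → Euc N → ℝ, IsDeltaSeq φ ∧ ∀ᶠ m in atTop,
      TendstoUniformlyOn (fun n => convol (f n) (φ m)) 0 atTop (thickening ε S)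

lemma key_tendsto {N : ℕ} {f : ℕ → Euc N → ℝ} {φ ψ : Euc N → ℝ} {C S : Set (Euc N)} {r ε : ℝ}
    (hC : IsCompact C) (hf : ∀ n, ContinuousOn (f n) C) (h1 : IsD0 φ) (h2 : IsD0 ψ)
    (s1 : tsupport φ ⊆ ball 0 r) (s2 : tsupport ψ ⊆ ball 0 r) (hr : 0 < r) (hrε : 3 * r ≤ ε)
    (hS : thickening ε S ⊆ C)
    (hb : TendstoUniformlyOn (fun n => convol (f n) φ) 0 atTop (thickening ε S)) :
    TendstoUniformlyOn (fun n => convol (f n) (convol φ ψ)) 0 atTop (thickening r S) := by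
  rw [Metric.tendstoUniformlyOn_iff] at *
  intro η hη
  filter_upwards [hb (η / 2) (by positivity)] with n hn x hx
  have := key_bound hC (hf n) h1 h2 s1 s2 ((thickening_mono hrε S).trans hS) (η := η / 2)
    (fun x hx => by
      have := hn x (thickening_mono (by linarith) S hx)
      simp only [Pi.zero_apply, dist_zero_left, Real.norm_eq_abs] at this
      exact this.le) x hx
  simp only [Pi.zero_apply, dist_zero_left, Real.norm_eq_abs]
  linarith

lemma GoodSet.union {N : ℕ} {f : ℕ → Euc N → ℝ} {U S T : Set (Euc N)}
    (hf : ∀ n, ContinuousOn (f n) U) (hS : GoodSet f U S) (hT : GoodSet f U T) :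
    GoodSet f U (S ∪ T) := by
  obtain ⟨ε, hε, C, hC, hCU, hSC, φ, hφ, h1⟩ := hS
  obtain ⟨ε', hε', C', hC', hCU', hTC, ψ, hψ, h2⟩ := hT
  obtain ⟨r, hr, hrε, hrε'⟩ : ∃ r : ℝ, 0 < r ∧ 3 * r ≤ ε ∧ 3 * r ≤ ε' := by
    refine ⟨min ε ε' / 3, by positivity, ?_, ?_⟩
    · linarith [min_le_left ε ε']
    · linarith [min_le_right ε ε']
  refine ⟨r, hr, C ∪ C', hC.union hC', Set.union_subset hCU hCU', ?_, _, hφ.convol hψ, ?_⟩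
  · rw [thickening_union]
    exact Set.union_subset_union ((thickening_mono (by linarith) S).trans hSC)
      ((thickening_mono (by linarith) T).trans hTC)
  · filter_upwards [h1, h2, hφ.eventually hr, hψ.eventually hr] with m m1 m2 s1 s2
    rw [thickening_union]
    have a1 := key_tendsto hC (fun n => (hf n).mono hCU) (hφ.1 m) (hψ.1 m) s1 s2 hr hrε hSC m1
    have a2 := key_tendsto hC' (fun n => (hf n).mono hCU') (hψ.1 m) (hφ.1 m) s2 s1 hr hrε' hTC m2
    rw [convol_comm (ψ m)] at a2
    rw [Metric.tendstoUniformlyOn_iff] at *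
    intro η hη
    filter_upwards [a1 η hη, a2 η hη] with n n1 n2 x hx
    exact hx.elim (n1 x) (n2 x)

/-- If `{U_α}` is a family of open sets with union `U`, and `(f_n) ∼ (0)` on each
`U_α`, then `(f_n) ∼ (0)` on `U`. -/
theorem simZero_of_cover {N : ℕ} {ι : Type*} (Uα : ι → Set (Euc N))
    (hopen : ∀ i, IsOpen (Uα i))
    (f : ℕ → Euc N → ℝ) (hf : ∀ n, ContinuousOn (f n) (⋃ i, Uα i))
    (h : ∀ i, SimZero f (Uα i)) :
    SimZero f (⋃ i, Uα i) := by
  intro K hK hKU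
  have hgood : GoodSet f (⋃ i, Uα i) K := by
    refine hK.induction_on (p := GoodSet f (⋃ i, Uα i)) ?_ ?_ (fun _ _ hs ht => hs.union hf ht) ?_
    · obtain ⟨φ, hφ⟩ := exists_deltaSeq N
      refine ⟨1, one_pos, ∅, isCompact_empty, Set.empty_subset _, by simp, φ, hφ, ?_⟩
      exact Eventually.of_forall fun m => by simp [tendstoUniformlyOn_empty]
    · rintro S T hST ⟨ε, hε, C, hC, hCU, hTC, φ, hφ, h1⟩
      exact ⟨ε, hε, C, hC, hCU, (thickening_subset_of_subset ε hST).trans hTC, φ, hφ,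
        h1.mono fun m hm => hm.mono (thickening_subset_of_subset ε hST)⟩
    · intro x hx
      obtain ⟨i, hi⟩ := Set.mem_iUnion.1 (hKU hx)
      obtain ⟨R, hR, hRU⟩ := Metric.nhds_basis_closedBall.mem_iff.1 ((hopen i).mem_nhds hi)
      obtain ⟨φ, hφ, m₀, hm⟩ := h i _ (isCompact_closedBall x R) hRU
      have hsub : thickening (R / 2) (ball x (R / 2)) ⊆ closedBall x R := by
        intro y hy
        obtain ⟨z, hz, hyz⟩ := mem_thickening_iff.1 hy
        rw [mem_ball] at hz
        rw [mem_closedBall]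
        linarith [dist_triangle y z x]
      exact ⟨ball x (R / 2), mem_nhdsWithin_of_mem_nhds (ball_mem_nhds x (half_pos hR)),
        R / 2, half_pos hR, closedBall x R, isCompact_closedBall x R,
        hRU.trans (Set.subset_iUnion Uα i), hsub, φ, hφ,
        (eventually_ge_atTop m₀).mono fun m h' => (hm m h').mono hsub⟩
  obtain ⟨ε, hε, C, hC, hCU, hKC, φ, hφ, h1⟩ := hgood
  obtain ⟨m₀, hm⟩ := eventually_atTop.1 h1
  exact ⟨φ, hφ, m₀, fun m h' => (hm m h').mono (self_subset_thickening hε K)⟩
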